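/- arXiv:1210.7208 — 2 statements merged into one kernel-verified Lean document; each statement's English description precedes it below -/
import Mathlib

section
/- There exists a constant C_T > 0 such that for all x, y ∈ [0,1] and all t ∈ [0,T], ∫₀^t ∫₀^∞ [p̃(s,x,z) − p̃(s,y,z)]² dz ds ≤ C_T |x − y|^{1/3}. -/
open MeasureTheory Real

noncomputable def heatp (s x y : ℝ) : ℝ :=
  (1 / Real.sqrt (4 * Real.pi * s)) *
    (Real.exp (-(x - y) ^ 2 / (4 * s)) - Real.exp (-(x + y) ^ 2 / (4 * s)))

noncomputable def ptilde (s x y : ℝ) : ℝ :=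
  if x = 0 then y ^ 2 / (s * Real.sqrt (4 * Real.pi * s)) * Real.exp (-y ^ 2 / (4 * s))
  else (y / x) * heatp s x y

noncomputable def phi (w : ℝ) : ℝ := (1 - Real.exp (-w)) / w

lemma phi_le_one {w : ℝ} (hw : 0 < w) : phi w ≤ 1 := by
  unfold phi; rw [div_le_one hw]; linarith [Real.add_one_le_exp (-w)]

lemma phi_nonneg {w : ℝ} (hw : 0 < w) : 0 ≤ phi w := by
  unfold phi
  have : Real.exp (-w) ≤ 1 := Real.exp_le_one_iff.2 (by linarith)
  apply div_nonneg <;> linarith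

lemma phi_mul {w : ℝ} (hw : 0 < w) : phi w * w = 1 - Real.exp (-w) := by
  unfold phi; field_simp

lemma exp_sub_le (a b : ℝ) : Real.exp (-b) * (b - a) ≤ Real.exp (-a) - Real.exp (-b) := by
  have h := Real.add_one_le_exp (b - a)
  have : Real.exp (-a) = Real.exp (-b) * Real.exp (b - a) := by rw [← Real.exp_add]; ring_nf
  rw [this]
  nlinarith [Real.exp_pos (-b)]

lemma phi_anti {a b : ℝ} (ha : 0 < a) (hab : a ≤ b) : phi b ≤ phi a := by
  have hb : 0 < b := ha.trans_le hab
  have h1 := exp_sub_le b a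
  have h2 := exp_sub_le 0 a
  simp at h2
  have h3 := phi_mul ha
  have h4 := phi_mul hb
  have h5 : Real.exp (-a) ≤ phi a := by
    refine le_of_mul_le_mul_right ?_ ha
    linarith
  refine le_of_mul_le_mul_right ?_ hb
  nlinarith

lemma phi_lip {a b : ℝ} (ha : 0 < a) (hab : a ≤ b) : phi a - phi b ≤ (b - a) * phi b := by
  have hb : 0 < b := ha.trans_le hab
  have h1 := exp_sub_le a b
  have h3 := phi_mul ha
  have h4 := phi_mul hb
  have h5 := phi_le_one ha
  refine le_of_mul_le_mul_right ?_ hb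
  nlinarith

noncomputable def QQ (X Y : ℝ) : ℝ := 2 + phi (X^2) / 2 + phi (Y^2) / 2
  - Real.exp (-((X-Y)^2/4)) * (2 + (1 + (X-Y)^2/2) * phi (X*Y))

lemma QQ_comm (X Y : ℝ) : QQ X Y = QQ Y X := by
  unfold QQ; rw [mul_comm X Y, show (X-Y)^2 = (Y-X)^2 by ring]; ring

lemma QQ_le_three {X Y : ℝ} (hX : 0 < X) (hY : 0 < Y) : QQ X Y ≤ 3 := by
  unfold QQ
  have h1 := phi_le_one (show 0 < X^2 by positivity)
  have h2 := phi_le_one (show 0 < Y^2 by positivity)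
  have h3 := phi_nonneg (mul_pos hX hY)
  have : 0 ≤ Real.exp (-((X-Y)^2/4)) * (2 + (1 + (X-Y)^2/2) * phi (X*Y)) := by positivity
  linarith

lemma QQ_le_lin {X Y : ℝ} (hX : 0 < X) (hXY : X ≤ Y) (h1 : Y - X ≤ 1) : QQ X Y ≤ 3 * (Y - X) := by
  have hY : 0 < Y := hX.trans_le hXY
  have e1 := phi_lip (show 0 < X^2 by positivity) (show X^2 ≤ Y^2 by gcongr)
  have e2 := phi_anti (show 0 < X*Y by positivity) (show X*Y ≤ Y^2 by nlinarith)
  have e3 := phi_le_one (show 0 < X*Y by positivity)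
  have e4 := phi_nonneg (show 0 < X*Y by positivity)
  have e5 : Y * phi (Y^2) ≤ 1 := by
    rcases le_total Y 1 with h | h
    · have := phi_le_one (show 0 < Y^2 by positivity)
      have := phi_nonneg (show 0 < Y^2 by positivity)
      nlinarith
    · have := phi_mul (show 0 < Y^2 by positivity)
      have := phi_nonneg (show 0 < Y^2 by positivity)
      have := Real.exp_pos (-Y^2)
      have : 0 ≤ phi (Y^2) * Y * (Y - 1) := by
        have : 0 ≤ Y - 1 := by linarith
        positivity
      nlinarith [Real.exp_pos (-(Y^2))]
  have e6 : phi (X^2) - phi (Y^2) ≤ 2 * (Y - X) := by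
    have p := phi_nonneg (show 0 < Y^2 by positivity)
    have : (Y^2 - X^2) * phi (Y^2) ≤ (2 * Y * (Y - X)) * phi (Y^2) := by
      gcongr; nlinarith
    nlinarith
  have e7 := Real.add_one_le_exp (-((X-Y)^2/4))
  have e8 : Real.exp (-((X-Y)^2/4)) ≤ 1 := Real.exp_le_one_iff.2 (by nlinarith [sq_nonneg (X-Y)])
  have e9 : (1 - (X-Y)^2/4) * (2 + phi (X*Y)) ≤
     Real.exp (-((X-Y)^2/4)) * (2 + (1 + (X-Y)^2/2) * phi (X*Y)) := by
    gcongr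
    · linarith
    · nlinarith [sq_nonneg (X-Y)]
  have e10 : (X-Y)^2 ≤ Y - X := by nlinarith
  unfold QQ
  nlinarith [sq_nonneg (X-Y)]

lemma QQ_le {X Y : ℝ} (hX : 0 < X) (hY : 0 < Y) : QQ X Y ≤ 3 * |X - Y| ^ ((1:ℝ)/3) := by
  wlog hXY : X ≤ Y generalizing X Y
  · rw [QQ_comm, abs_sub_comm]; exact this hY hX (by linarith)
  have ha : |X - Y| = Y - X := by rw [abs_sub_comm, abs_of_nonneg]; linarith
  rw [ha]
  rcases le_total (Y - X) 1 with h | h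
  · refine (QQ_le_lin hX hXY h).trans ?_
    gcongr
    exact Real.self_le_rpow_of_le_one (by linarith) h (by norm_num)
  · refine (QQ_le_three hX hY).trans ?_
    have := Real.one_le_rpow h (show (0:ℝ) ≤ 1/3 by norm_num)
    linarith

lemma gauss_mom (m s : ℝ) (hs : 0 < s) :
    Integrable (fun z : ℝ => z^2 * Real.exp (-(z - m)^2 / (2*s))) ∧
    ∫ z : ℝ, z^2 * Real.exp (-(z - m)^2 / (2*s)) = (m^2 + s) * √(2 * π * s) := by
  set v : NNReal := ⟨s, hs.le⟩ with hv
  have hvs : (v : ℝ) = s := rfl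
  have hv0 : v ≠ 0 := by intro h; have := congrArg NNReal.toReal h; simp [hvs] at this; linarith
  have hM : MemLp id 2 (ProbabilityTheory.gaussianReal m v) :=
    ProbabilityTheory.memLp_id_gaussianReal (2 : NNReal)
  have hq : 0 < √(2 * π * s) := by positivity
  have h1 := ProbabilityTheory.variance_eq_sub hM
  rw [ProbabilityTheory.variance_id_gaussianReal] at h1
  simp only [Pi.pow_apply, id] at h1
  rw [ProbabilityTheory.integral_id_gaussianReal,
    ProbabilityTheory.integral_gaussianReal_eq_integral_smul hv0] at h1
  have h2 := hM.integrable_sq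
  rw [ProbabilityTheory.gaussianReal_of_var_ne_zero m hv0, integrable_withDensity_iff
    (ProbabilityTheory.measurable_gaussianPDF m v) (by simp [ProbabilityTheory.gaussianPDF])] at h2
  have hfe : (fun z : ℝ => z^2 * Real.exp (-(z - m)^2 / (2*s))) =
      fun z => √(2 * π * s) * (ProbabilityTheory.gaussianPDFReal m v z • z^2) := by
    ext z
    simp only [ProbabilityTheory.gaussianPDFReal, hvs, smul_eq_mul]
    field_simp
  constructor
  · rw [hfe]
    refine Integrable.const_mul ?_ _
    refine h2.congr (Filter.Eventually.of_forall fun z => ?_)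
    simp [ProbabilityTheory.gaussianPDF,
      ENNReal.toReal_ofReal (ProbabilityTheory.gaussianPDFReal_nonneg m v z), mul_comm]
  · rw [hfe, integral_const_mul]
    rw [hvs] at h1
    have : ∫ x : ℝ, ProbabilityTheory.gaussianPDFReal m v x • x^2 = m^2 + s := by linarith
    rw [this, mul_comm]

lemma gauss_prod (a b s : ℝ) (hs : 0 < s) :
    Integrable (fun z : ℝ => z^2 * (Real.exp (-(z - a)^2 / (4*s)) * Real.exp (-(z - b)^2 / (4*s)))) ∧
    ∫ z : ℝ, z^2 * (Real.exp (-(z - a)^2 / (4*s)) * Real.exp (-(z - b)^2 / (4*s)))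
      = Real.exp (-(a-b)^2/(8*s)) * ((((a+b)/2)^2 + s) * √(2 * π * s)) := by
  have hfe : (fun z : ℝ => z^2 * (Real.exp (-(z - a)^2 / (4*s)) * Real.exp (-(z - b)^2 / (4*s)))) =
      fun z => Real.exp (-(a-b)^2/(8*s)) * (z^2 * Real.exp (-(z - (a+b)/2)^2 / (2*s))) := by
    ext z
    have : Real.exp (-(z - a)^2 / (4*s)) * Real.exp (-(z - b)^2 / (4*s)) =
      Real.exp (-(a-b)^2/(8*s)) * Real.exp (-(z - (a+b)/2)^2 / (2*s)) := by
      rw [← Real.exp_add, ← Real.exp_add]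
      congr 1
      field_simp
      ring
    rw [this]; ring
  obtain ⟨h1, h2⟩ := gauss_mom ((a+b)/2) s hs
  rw [hfe]
  exact ⟨h1.const_mul _, by rw [integral_const_mul, h2]⟩

lemma gauss_sum (w c : Fin 4 → ℝ) (s : ℝ) (hs : 0 < s) :
    Integrable (fun z : ℝ => z^2 * (∑ i, w i * Real.exp (-(z - c i)^2 / (4*s)))^2) ∧
    ∫ z : ℝ, z^2 * (∑ i, w i * Real.exp (-(z - c i)^2 / (4*s)))^2
     = ∑ i, ∑ j, w i * w j * (Real.exp (-(c i-c j)^2/(8*s)) * ((((c i+c j)/2)^2 + s) * √(2 * π * s))) := by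
  have hfe : (fun z : ℝ => z^2 * (∑ i, w i * Real.exp (-(z - c i)^2 / (4*s)))^2) =
      fun z => ∑ i, ∑ j, w i * w j *
        (z^2 * (Real.exp (-(z - c i)^2 / (4*s)) * Real.exp (-(z - c j)^2 / (4*s)))) := by
    ext z
    rw [sq (∑ i, _), Finset.sum_mul_sum, Finset.mul_sum]
    refine Finset.sum_congr rfl fun i _ => ?_
    rw [Finset.mul_sum]
    refine Finset.sum_congr rfl fun j _ => ?_
    ring
  have hi : ∀ i j, Integrable fun z : ℝ => w i * w j *
        (z^2 * (Real.exp (-(z - c i)^2 / (4*s)) * Real.exp (-(z - c j)^2 / (4*s)))) :=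
    fun i j => (gauss_prod (c i) (c j) s hs).1.const_mul _
  rw [hfe]
  refine ⟨integrable_finsetSum _ fun i _ => integrable_finsetSum _ fun j _ => hi i j, ?_⟩
  rw [integral_finsetSum _ fun i _ => integrable_finsetSum _ fun j _ => hi i j]
  refine Finset.sum_congr rfl fun i _ => ?_
  rw [integral_finsetSum _ fun j _ => hi i j]
  refine Finset.sum_congr rfl fun j _ => ?_
  rw [integral_const_mul, (gauss_prod (c i) (c j) s hs).2]

lemma pt_sq_eq {s x y : ℝ} (hs : 0 < s) (hx : 0 < x) (hy : 0 < y) (z : ℝ) :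
    (ptilde s x z - ptilde s y z)^2 = (1 / (4 * π * s)) *
      (z^2 * (∑ i, (![1/x, -(1/x), -(1/y), 1/y] : Fin 4 → ℝ) i *
        Real.exp (-(z - (![x, -x, y, -y] : Fin 4 → ℝ) i)^2 / (4*s)))^2) := by
  have h : (1 / (4 * π * s)) = (1 / √(4 * π * s))^2 := by
    rw [div_pow, Real.sq_sqrt (by positivity)]; simp
  rw [h]
  simp only [ptilde, hx.ne', hy.ne', if_false, heatp, Fin.sum_univ_four]
  simp only [Matrix.cons_val]
  rw [show (z - -x) = x + z by ring, show (z - -y) = y + z by ring,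
    show (z - x)^2 = (x - z)^2 by ring, show (z - y)^2 = (y - z)^2 by ring]
  ring

lemma pt_int {s x y : ℝ} (hs : 0 < s) (hx : 0 < x) (hy : 0 < y) :
    Integrable (fun z => (ptilde s x z - ptilde s y z)^2) ∧
    ∫ z in Set.Ioi (0:ℝ), (ptilde s x z - ptilde s y z)^2 =
      1 / √(8 * π * s) * QQ (x / √(2*s)) (y / √(2*s)) := by
  have hg := gauss_sum ![1/x, -(1/x), -(1/y), 1/y] ![x, -x, y, -y] s hs
  have hfe := funext (pt_sq_eq hs hx hy)
  constructor
  · rw [hfe]; exact hg.1.const_mul _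
  have hev : ∀ z, (ptilde s x |z| - ptilde s y |z|)^2 = (ptilde s x z - ptilde s y z)^2 := by
    intro z
    rcases abs_cases z with ⟨h, _⟩ | ⟨h, _⟩
    · rw [h]
    · rw [h]
      simp only [ptilde, hx.ne', hy.ne', if_false, heatp]
      rw [show x - -z = x + z by ring, show x + -z = x - z by ring,
        show y - -z = y + z by ring, show y + -z = y - z by ring]
      ring
  have h2 := integral_comp_abs (f := fun z => (ptilde s x z - ptilde s y z)^2)
  simp only [hev] at h2
  have h3 : ∫ z, (ptilde s x z - ptilde s y z)^2 =
      1 / √(8 * π * s) * (2 * QQ (x / √(2*s)) (y / √(2*s))) := by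
    rw [hfe, integral_const_mul, hg.2]
    simp only [Fin.sum_univ_four, Matrix.cons_val]
    have hq : 0 < √(2 * π * s) := by positivity
    have hq2 : √(2 * π * s)^2 = 2 * π * s := Real.sq_sqrt (by positivity)
    have h8 : √(8 * π * s) = 2 * √(2 * π * s) := by
      rw [show 8 * π * s = 2^2 * (2 * π * s) by ring, Real.sqrt_mul (by norm_num), Real.sqrt_sq (by norm_num)]
    have hr : 0 < √(2 * s) := by positivity
    have hr2 : √(2 * s)^2 = 2 * s := Real.sq_sqrt (by positivity)
    rw [h8, show 4 * π * s = 2 * √(2 * π * s)^2 by rw [hq2]; ring]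
    unfold QQ phi
    have t1 : (x / √(2*s))^2 = x^2/(2*s) := by rw [div_pow, hr2]
    have t2 : (y / √(2*s))^2 = y^2/(2*s) := by rw [div_pow, hr2]
    have t3 : (x / √(2*s)) * (y / √(2*s)) = x*y/(2*s) := by rw [div_mul_div_comm, ← sq, hr2]
    have t4 : (x / √(2*s) - y / √(2*s))^2 = (x-y)^2/(2*s) := by rw [← sub_div, div_pow, hr2]
    rw [t1, t2, t3, t4]
    -- normalise exponentials
    have u0 : ∀ c : ℝ, Real.exp (-(c - c)^2/(8*s)) = 1 := by intro c; simp
    have u1 : ∀ c : ℝ, Real.exp (-(c - -c)^2/(8*s)) = Real.exp (-(c^2/(2*s))) := by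
      intro c; congr 1; field_simp; ring
    have u1' : ∀ c : ℝ, Real.exp (-(-c - c)^2/(8*s)) = Real.exp (-(c^2/(2*s))) := by
      intro c; congr 1; field_simp; ring
    have e2 : Real.exp (-(x+y)^2/(8*s)) = Real.exp (-((x-y)^2/(8*s))) * Real.exp (-(x*y/(2*s))) := by
      rw [← Real.exp_add]; congr 1; field_simp; ring
    have v1 : -(x - y)^2/(8*s) = -((x-y)^2/(8*s)) := by ring
    have v2 : -(y - x)^2/(8*s) = -((x-y)^2/(8*s)) := by ring
    have v3 : -(-x - -y)^2/(8*s) = -((x-y)^2/(8*s)) := by ring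
    have v4 : -(-y - -x)^2/(8*s) = -((x-y)^2/(8*s)) := by ring
    have v5 : -(x - -y)^2/(8*s) = -(x+y)^2/(8*s) := by ring
    have v6 : -(y - -x)^2/(8*s) = -(x+y)^2/(8*s) := by ring
    have v7 : -(-x - y)^2/(8*s) = -(x+y)^2/(8*s) := by ring
    have v8 : -(-y - x)^2/(8*s) = -(x+y)^2/(8*s) := by ring
    have v9 : -((x-y)^2/(2*s)/4) = -((x-y)^2/(8*s)) := by field_simp; ring
    rw [u0 x, u0 y, u0 (-x), u0 (-y), u1, u1, u1', u1', v1, v2, v3, v4, v5, v6, v7, v8, v9, e2]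
    generalize Real.exp (-((x-y)^2/(8*s))) = A
    generalize Real.exp (-(x*y/(2*s))) = B
    generalize Real.exp (-(x^2/(2*s))) = E
    generalize Real.exp (-(y^2/(2*s))) = F
    generalize √(2 * π * s) = q at *
    field_simp
    ring
  linarith

lemma pt_meas (s x : ℝ) : Measurable (ptilde s x) := by
  unfold ptilde heatp
  by_cases h : x = 0
  · simp only [h, if_true]; fun_prop
  · simp only [h, if_false]; fun_prop

noncomputable def BB (s x y : ℝ) : ℝ := 3 * s ^ (-(2:ℝ)/3) * |x - y| ^ ((1:ℝ)/3)

lemma BB_nonneg {s : ℝ} (hs : 0 < s) (x y : ℝ) : 0 ≤ BB s x y := by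
  unfold BB; positivity

lemma pt_bound_pos {s x y : ℝ} (hs : 0 < s) (hx : 0 < x) (hy : 0 < y) :
    ∫ z in Set.Ioi (0:ℝ), (ptilde s x z - ptilde s y z)^2 ≤ BB s x y := by
  rw [(pt_int hs hx hy).2]
  have hr : 0 < √(2*s) := by positivity
  have h1 := QQ_le (div_pos hx hr) (div_pos hy hr)
  rw [← sub_div, abs_div, abs_of_pos hr] at h1
  have hss : 0 < √s := by positivity
  have h2 : |x - y| / √(2*s) ≤ |x - y| / √s := by
    gcongr; linarith
  have h3 : (|x - y| / √(2*s)) ^ ((1:ℝ)/3) ≤ (|x - y| / √s) ^ ((1:ℝ)/3) := by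
    gcongr
  have h4 : 1 / √(8 * π * s) ≤ 1 / √s := by
    gcongr; nlinarith [Real.pi_gt_three]
  have h5 : 1 / √s * (|x - y| / √s) ^ ((1:ℝ)/3) = s ^ (-(2:ℝ)/3) * |x - y| ^ ((1:ℝ)/3) := by
    have h6 : s ^ (-(2:ℝ)/3) = (√s)⁻¹ * ((√s) ^ ((1:ℝ)/3))⁻¹ := by
      rw [Real.sqrt_eq_rpow, ← Real.rpow_mul hs.le, ← Real.rpow_neg hs.le, ← Real.rpow_neg hs.le,
        ← Real.rpow_add hs]
      norm_num
    rw [Real.div_rpow (abs_nonneg _) hss.le, h6]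
    ring
  calc 1 / √(8 * π * s) * QQ (x / √(2*s)) (y / √(2*s))
      ≤ 1 / √(8 * π * s) * (3 * (|x - y| / √s) ^ ((1:ℝ)/3)) := by
        gcongr; linarith
    _ ≤ 1 / √s * (3 * (|x - y| / √s) ^ ((1:ℝ)/3)) := by gcongr
    _ = 3 * (1 / √s * (|x - y| / √s) ^ ((1:ℝ)/3)) := by ring
    _ = BB s x y := by rw [h5]; unfold BB; ring

lemma pt_lbound_pos {s x y : ℝ} (hs : 0 < s) (hx : 0 < x) (hy : 0 < y) :
    ∫⁻ z in Set.Ioi (0:ℝ), ENNReal.ofReal ((ptilde s x z - ptilde s y z)^2)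
      ≤ ENNReal.ofReal (BB s x y) := by
  rw [← ofReal_integral_eq_lintegral_ofReal (pt_int hs hx hy).1.integrableOn
    (Filter.Eventually.of_forall fun z => sq_nonneg _)]
  exact ENNReal.ofReal_le_ofReal (pt_bound_pos hs hx hy)

lemma pt_tendsto {s : ℝ} (hs : 0 < s) (z : ℝ) :
    Filter.Tendsto (fun x => ptilde s x z) (nhdsWithin 0 (Set.Ioi 0)) (nhds (ptilde s 0 z)) := by
  have hd : HasDerivAt (fun x => z * heatp s x z) (ptilde s 0 z) 0 := by
    unfold heatp
    have e1 : HasDerivAt (fun x : ℝ => -(x - z)^2/(4*s)) (-(2 * (0 - z))/(4*s)) 0 := by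
      have := ((((hasDerivAt_id (0:ℝ)).sub_const z).pow 2).neg).div_const (4*s)
      simpa using this
    have e2 : HasDerivAt (fun x : ℝ => -(x + z)^2/(4*s)) (-(2 * (0 + z))/(4*s)) 0 := by
      have := ((((hasDerivAt_id (0:ℝ)).add_const z).pow 2).neg).div_const (4*s)
      simpa using this
    have := (((e1.exp.sub e2.exp).const_mul (1 / √(4 * π * s))).const_mul z)
    refine this.congr_deriv ?_
    simp only [ptilde, if_true]
    have : 0 < √(4 * π * s) := by positivity
    rw [show (0 - z)^2 = z^2 by ring, show (0 + z)^2 = z^2 by ring]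
    field_simp
    ring
  have h := (hasDerivAt_iff_tendsto_slope.1 hd).mono_left
    (nhdsWithin_mono 0 (fun x (hx : x ∈ Set.Ioi (0:ℝ)) => ne_of_gt hx))
  refine h.congr' ?_
  filter_upwards [self_mem_nhdsWithin] with x hx
  have hx' : x ≠ 0 := ne_of_gt hx
  have h0 : heatp s 0 z = 0 := by simp [heatp]
  simp only [slope_def_field, ptilde, hx', if_false, h0]
  field_simp
  simp

lemma pt_lbound_zero {s y : ℝ} (hs : 0 < s) (hy : 0 < y) :
    ∫⁻ z in Set.Ioi (0:ℝ), ENNReal.ofReal ((ptilde s 0 z - ptilde s y z)^2)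
      ≤ ENNReal.ofReal (BB s 0 y) := by
  have hF := lintegral_liminf_le (μ := volume.restrict (Set.Ioi (0:ℝ)))
    (f := fun (x : ℝ) z => ENNReal.ofReal ((ptilde s x z - ptilde s y z)^2))
    (u := nhdsWithin 0 (Set.Ioi 0))
    (fun x => (((pt_meas s x).sub (pt_meas s y)).pow_const 2).ennreal_ofReal)
  have hl : ∀ z, Filter.liminf (fun x => ENNReal.ofReal ((ptilde s x z - ptilde s y z)^2))
      (nhdsWithin 0 (Set.Ioi 0)) = ENNReal.ofReal ((ptilde s 0 z - ptilde s y z)^2) := fun z =>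
    (ENNReal.tendsto_ofReal (((pt_tendsto hs z).sub_const _).pow 2)).liminf_eq
  simp only [hl] at hF
  refine hF.trans ?_
  have hB : Filter.Tendsto (fun x => ENNReal.ofReal (BB s x y)) (nhdsWithin 0 (Set.Ioi 0))
      (nhds (ENNReal.ofReal (BB s 0 y))) := by
    refine ENNReal.tendsto_ofReal (Filter.Tendsto.mono_left ?_ nhdsWithin_le_nhds)
    have : Continuous (fun x => BB s x y) := by
      unfold BB
      refine continuous_const.mul (Continuous.rpow_const (by fun_prop) (fun x => Or.inr (by norm_num)))
    exact this.tendsto 0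
  rw [← hB.liminf_eq]
  refine Filter.liminf_le_liminf ?_
  filter_upwards [self_mem_nhdsWithin] with x hx
  exact pt_lbound_pos hs hx hy

lemma pt_lbound {s x y : ℝ} (hs : 0 < s) (hx : 0 ≤ x) (hy : 0 ≤ y) :
    ∫⁻ z in Set.Ioi (0:ℝ), ENNReal.ofReal ((ptilde s x z - ptilde s y z)^2)
      ≤ ENNReal.ofReal (BB s x y) := by
  rcases hx.eq_or_lt with rfl | hx
  · rcases hy.eq_or_lt with rfl | hy
    · simp
    · exact pt_lbound_zero hs hy
  · rcases hy.eq_or_lt with rfl | hy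
    · have := pt_lbound_zero hs hx
      have hb : BB s x 0 = BB s 0 x := by unfold BB; rw [abs_sub_comm]
      rw [hb]
      refine le_of_eq_of_le ?_ this
      congr 1; ext z; congr 1; ring
    · exact pt_lbound_pos hs hx hy

lemma pt_bound {s x y : ℝ} (hs : 0 < s) (hx : 0 ≤ x) (hy : 0 ≤ y) :
    ∫ z in Set.Ioi (0:ℝ), (ptilde s x z - ptilde s y z)^2 ≤ BB s x y := by
  rw [integral_eq_lintegral_of_nonneg_ae (f := fun z => (ptilde s x z - ptilde s y z)^2)
    (Filter.Eventually.of_forall fun z => sq_nonneg _)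
    (((pt_meas s x).sub (pt_meas s y)).pow_const 2).aestronglyMeasurable]
  exact ENNReal.toReal_le_of_le_ofReal (BB_nonneg hs x y) (pt_lbound hs hx hy)

theorem ptilde_spatial_holder (T : ℝ) (hT : 0 < T) :
    ∃ C > 0, ∀ x ∈ Set.Icc (0:ℝ) 1, ∀ y ∈ Set.Icc (0:ℝ) 1, ∀ t ∈ Set.Icc (0:ℝ) T,
      ∫ s in Set.Ioc (0:ℝ) t, ∫ z in Set.Ioi (0:ℝ),
        (ptilde s x z - ptilde s y z) ^ 2 ≤ C * |x - y| ^ ((1:ℝ)/3) := by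
  refine ⟨9 * T ^ ((1:ℝ)/3), by positivity, ?_⟩
  intro x hx y hy t ht
  have hint : IntegrableOn (fun s : ℝ => s ^ (-(2:ℝ)/3)) (Set.Ioc 0 t) := by
    rw [← intervalIntegrable_iff_integrableOn_Ioc_of_le ht.1]
    exact intervalIntegral.intervalIntegrable_rpow' (by norm_num)
  have hval : ∫ s in Set.Ioc (0:ℝ) t, s ^ (-(2:ℝ)/3) = 3 * t ^ ((1:ℝ)/3) := by
    rw [← intervalIntegral.integral_of_le ht.1, integral_rpow (Or.inl (by norm_num)),
      show -(2:ℝ)/3 + 1 = 1/3 by norm_num, Real.zero_rpow (by norm_num)]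
    ring
  have hBi : IntegrableOn (fun s => BB s x y) (Set.Ioc 0 t) := by
    unfold BB
    exact (hint.const_mul 3).mul_const _
  calc _ ≤ ∫ s in Set.Ioc (0:ℝ) t, BB s x y := by
        refine integral_mono_of_nonneg (Filter.Eventually.of_forall fun s =>
          integral_nonneg fun z => sq_nonneg _) hBi ?_
        filter_upwards [ae_restrict_mem measurableSet_Ioc] with s hs
        exact pt_bound hs.1 hx.1 hy.1
    _ = 9 * t ^ ((1:ℝ)/3) * |x - y| ^ ((1:ℝ)/3) := by
        unfold BB
        rw [integral_mul_const, integral_const_mul, hval]; ring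
    _ ≤ 9 * T ^ ((1:ℝ)/3) * |x - y| ^ ((1:ℝ)/3) := by
        have := ht.1
        gcongr
        exact ht.2
end

section
/- There exists a constant D_T > 0 such that for all x ≥ 0 and all 0 ≤ s ≤ t ≤ T: ∫_s^t ∫₀^∞ p̃(r,x,y)² dy dr + ∫₀^s ∫₀^∞ [p̃(r+(t−s),x,y) − p̃(r,x,y)]² dy dr ≤ D_T (t−s)^{1/2}. -/
open MeasureTheory Real

lemma aux_E2 (r x y : ℝ) (hr : 0 < r) :
    Real.exp (-(x + y) ^ 2 / (4 * r)) =
      Real.exp (-(x - y) ^ 2 / (4 * r)) * Real.exp (-(x * y / r)) := by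
  rw [← Real.exp_add]; congr 1; field_simp; ring

/-- exact pointwise description of the kernel -/
lemma pt_bound_s7 (r x y : ℝ) (hr : 0 < r) (hx : 0 ≤ x) (hy : 0 < y) :
    0 ≤ ptilde r x y ∧ ptilde r x y ≤
      (1 / Real.sqrt (4 * Real.pi * r)) * Real.exp (-(x - y) ^ 2 / (4 * r)) *
        (4 * (1 + (x - y) ^ 2 / r)) := by
  have hc : 0 < Real.sqrt (4 * Real.pi * r) := Real.sqrt_pos.2 (by positivity)
  rcases hx.eq_or_lt with rfl | hx
  · have e : ptilde r 0 y = (1 / Real.sqrt (4 * Real.pi * r)) *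
        Real.exp (-(0 - y) ^ 2 / (4 * r)) * ((0 - y) ^ 2 / r) := by
      simp only [ptilde, if_true]
      have : (0 - y) ^ 2 = y ^ 2 := by ring
      rw [this]; field_simp
    rw [e]
    refine ⟨by positivity, ?_⟩
    gcongr
    have : 0 ≤ (0 - y) ^ 2 / r := by positivity
    linarith
  · have e : ptilde r x y = (1 / Real.sqrt (4 * Real.pi * r)) *
        Real.exp (-(x - y) ^ 2 / (4 * r)) * (y / x * (1 - Real.exp (-(x * y / r)))) := by
      simp only [ptilde, heatp, if_neg hx.ne']
      rw [aux_E2 r x y hr]; ring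
    have hu : 0 < x * y / r := by positivity
    have h1 : Real.exp (-(x * y / r)) ≤ 1 := Real.exp_le_one_iff.2 (by linarith)
    have h2 : 1 - Real.exp (-(x * y / r)) ≤ x * y / r := by
      have := Real.add_one_le_exp (-(x * y / r)); linarith
    have h3 := Real.exp_pos (-(x * y / r))
    rw [e]
    refine ⟨?_, ?_⟩
    · have : 0 ≤ 1 - Real.exp (-(x * y / r)) := by linarith
      positivity
    · refine mul_le_mul_of_nonneg_left ?_ (by positivity)
      generalize Real.exp (-(x * y / r)) = E at *
      by_cases hc : y ≤ 2 * x
      · have : y / x ≤ 2 := by rw [div_le_iff₀ hx]; linarith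
        have h4 : y / x * (1 - E) ≤ 2 * 1 := by
          apply mul_le_mul this (by linarith) (by linarith) (by norm_num)
        have : 0 ≤ (x - y) ^ 2 / r := by positivity
        linarith
      · push Not at hc
        have h4 : y / x * (1 - E) ≤ y / x * (x * y / r) := by gcongr
        have h5 : y / x * (x * y / r) = y ^ 2 / r := by field_simp
        have h6 : y ^ 2 / r ≤ (4 * (x - y) ^ 2) / r := by
          gcongr; nlinarith
        have h7 : (4 * (x - y) ^ 2) / r = 4 * ((x - y) ^ 2 / r) := by ring
        linarith

lemma poly_exp (w : ℝ) (hw : 0 ≤ w) : Real.exp (-w / 4) ≤ 1728 / (1 + w) ^ 3 := by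
  have h1 : 1 + w ≤ 12 * Real.exp (w / 12) := by
    have := Real.add_one_le_exp (w / 12); linarith
  have h2 : (1 + w) ^ 3 ≤ (12 * Real.exp (w / 12)) ^ 3 := by gcongr
  have h3 : (12 * Real.exp (w / 12)) ^ 3 = 1728 * Real.exp (w / 4) := by
    rw [mul_pow, ← Real.exp_nat_mul]; norm_num; ring_nf
  rw [le_div_iff₀ (by positivity)]
  have h4 : Real.exp (-w / 4) * Real.exp (w / 4) = 1 := by
    rw [← Real.exp_add]; simp; ring
  have := Real.exp_pos (-w / 4)
  nlinarith

lemma pt_bound2 (r x y : ℝ) (hr : 0 < r) (hx : 0 ≤ x) (hy : 0 < y) :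
    ptilde r x y ≤ 6912 / Real.sqrt r / (1 + (x - y) ^ 2 / r) ^ 2 := by
  refine (pt_bound_s7 r x y hr hx hy).2.trans ?_
  have hw : 0 ≤ (x - y) ^ 2 / r := by positivity
  have e : -(x - y) ^ 2 / (4 * r) = -((x - y) ^ 2 / r) / 4 := by field_simp
  rw [e]
  generalize (x - y) ^ 2 / r = w at *
  have h1 : Real.sqrt r ≤ Real.sqrt (4 * Real.pi * r) := by
    apply Real.sqrt_le_sqrt; nlinarith [Real.pi_gt_three]
  have h0 : 0 < Real.sqrt r := Real.sqrt_pos.2 hr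
  calc _ ≤ 1 / Real.sqrt r * (1728 / (1 + w) ^ 3) * (4 * (1 + w)) := by
        gcongr; exact poly_exp w hw
    _ = _ := by field_simp; norm_num

lemma sqrt_deriv (r : ℝ) (hr : 0 < r) :
    HasDerivAt (fun s : ℝ => 1 / Real.sqrt (4 * Real.pi * s))
      (1 / Real.sqrt (4 * Real.pi * r) * (-1 / (2 * r))) r := by
  have hp : 0 < 4 * Real.pi * r := by positivity
  have hc : 0 < Real.sqrt (4 * Real.pi * r) := Real.sqrt_pos.2 hp
  have h1 := (((hasDerivAt_id r).const_mul (4 * Real.pi)).sqrt hp.ne').inv hc.ne'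
  simp only [id] at h1
  have h2 : (fun s : ℝ => 1 / Real.sqrt (4 * Real.pi * s)) =
    (fun s : ℝ => Real.sqrt (4 * Real.pi * s))⁻¹ := by ext; simp
  rw [h2]
  refine h1.congr_deriv ?_
  have := Real.sq_sqrt hp.le
  rw [this]; field_simp

lemma exp_deriv (r a : ℝ) (hr : 0 < r) :
    HasDerivAt (fun s : ℝ => Real.exp (-a / (4 * s)))
      (Real.exp (-a / (4 * r)) * (a / (4 * r ^ 2))) r := by
  have h1 : HasDerivAt (fun s : ℝ => -a / (4 * s)) (a / (4 * r ^ 2)) r := by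
    have := ((hasDerivAt_id r).const_mul 4).inv (by simp; exact hr.ne')
    have := this.const_mul (-a)
    simp only [id] at this
    refine (this.congr_deriv ?_).congr_of_eventuallyEq ?_
    · field_simp
    · filter_upwards with s
      simp only [Pi.inv_apply]; rw [div_eq_mul_inv]
  exact h1.exp

lemma pt_deriv (r x y : ℝ) (hr : 0 < r) (hx : 0 ≤ x) (hy : 0 < y) :
    ∃ d, HasDerivAt (fun s => ptilde s x y) d r ∧
      |d| ≤ ptilde r x y * (2 * (1 + (x - y) ^ 2 / r) / r) := by
  have hc : 0 < Real.sqrt (4 * Real.pi * r) := Real.sqrt_pos.2 (by positivity)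
  have hp := (pt_bound_s7 r x y hr hx hy).1
  have hw : 0 ≤ (x - y) ^ 2 / r := by positivity
  rcases hx.eq_or_lt with rfl | hx
  · refine ⟨ptilde r 0 y * (-3 / (2 * r) + ((0 - y) ^ 2 / r) / (4 * r)), ?_, ?_⟩
    · simp only [ptilde, if_true]
      have h := (((hasDerivAt_inv hr.ne').mul (sqrt_deriv r hr)).mul
        (exp_deriv r (y ^ 2) hr)).const_mul (y ^ 2)
      refine (h.congr_deriv ?_).congr_of_eventuallyEq ?_
      · simp only [Pi.mul_apply]
        field_simp; ring
      · filter_upwards with s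
        simp only [Pi.mul_apply]
        rw [div_eq_mul_inv, mul_inv]; ring
    · rw [abs_mul, abs_of_nonneg hp]
      apply mul_le_mul_of_nonneg_left _ hp
      generalize (0 - y) ^ 2 / r = w at *
      have : -3 / (2 * r) + w / (4 * r) = (-3 / 2 + w / 4) / r := by field_simp
      rw [this, abs_div, abs_of_pos hr]
      gcongr
      rw [abs_le]; constructor <;> linarith
  · have e : ptilde r x y = (1 / Real.sqrt (4 * Real.pi * r)) *
        Real.exp (-(x - y) ^ 2 / (4 * r)) * (y / x * (1 - Real.exp (-(x * y / r)))) := by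
      simp only [ptilde, heatp, if_neg hx.ne']
      rw [aux_E2 r x y hr]; ring
    refine ⟨ptilde r x y * ((-1 / 2 + ((x - y) ^ 2 / r) / 4) / r) -
      (1 / Real.sqrt (4 * Real.pi * r)) * Real.exp (-(x - y) ^ 2 / (4 * r)) *
        (y ^ 2 / r * Real.exp (-(x * y / r))) / r, ?_, ?_⟩
    · rw [e]
      simp only [ptilde, heatp, if_neg hx.ne']
      have h := ((sqrt_deriv r hr).mul ((exp_deriv r ((x - y) ^ 2) hr).sub
        (exp_deriv r ((x + y) ^ 2) hr))).const_mul (y / x)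
      refine h.congr_deriv ?_
      simp only [Pi.sub_apply]
      rw [aux_E2 r x y hr]
      field_simp; ring
    · set A := (1 / Real.sqrt (4 * Real.pi * r)) * Real.exp (-(x - y) ^ 2 / (4 * r)) with hA
      have hA0 : 0 < A := by positivity
      have hB : A * (y ^ 2 / r * Real.exp (-(x * y / r))) ≤ ptilde r x y := by
        rw [e]
        apply mul_le_mul_of_nonneg_left _ hA0.le
        have h1 : x * y / r * Real.exp (-(x * y / r)) ≤ 1 - Real.exp (-(x * y / r)) := by
          have h2 := Real.add_one_le_exp (x * y / r)
          have h3 := Real.exp_pos (-(x * y / r))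
          have h4 : Real.exp (-(x * y / r)) * Real.exp (x * y / r) = 1 := by
            rw [← Real.exp_add]; simp
          nlinarith
        calc _ = y / x * (x * y / r * Real.exp (-(x * y / r))) := by field_simp
          _ ≤ _ := by gcongr
      have hB0 : 0 ≤ A * (y ^ 2 / r * Real.exp (-(x * y / r))) := by positivity
      generalize A * (y ^ 2 / r * Real.exp (-(x * y / r))) = B at *
      generalize ptilde r x y = P at *
      generalize (x - y) ^ 2 / r = w at *
      have : P * ((-1 / 2 + w / 4) / r) - B / r = (P * (-1 / 2 + w / 4) - B) / r := by ring
      rw [this, abs_div, abs_of_pos hr, mul_div_assoc']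
      gcongr
      have := mul_nonneg hp hw
      rw [abs_le]; constructor <;> nlinarith

lemma pt_deriv2 (r x y : ℝ) (hr : 0 < r) (hx : 0 ≤ x) (hy : 0 < y) :
    ∃ d, HasDerivAt (fun s => ptilde s x y) d r ∧
      |d| ≤ 13824 / (r * Real.sqrt r) / (1 + (x - y) ^ 2 / r) := by
  obtain ⟨d, hd, hb⟩ := pt_deriv r x y hr hx hy
  refine ⟨d, hd, hb.trans ?_⟩
  have h := pt_bound2 r x y hr hx hy
  have hw : 0 ≤ (x - y) ^ 2 / r := by positivity
  generalize (x - y) ^ 2 / r = w at *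
  have h0 : 0 < Real.sqrt r := Real.sqrt_pos.2 hr
  calc _ ≤ 6912 / Real.sqrt r / (1 + w) ^ 2 * (2 * (1 + w) / r) := by gcongr
    _ = _ := by field_simp; norm_num

lemma pt_diff (r h x y : ℝ) (hr : 0 < r) (hh : 0 ≤ h) (hhr : h ≤ r) (hx : 0 ≤ x) (hy : 0 < y) :
    |ptilde (r + h) x y - ptilde r x y| ≤
      27648 * h / (r * Real.sqrt r) / (1 + (x - y) ^ 2 / r) := by
  have key : ∀ s ∈ Set.Icc r (r + h), ∃ d, HasDerivAt (fun s => ptilde s x y) d s ∧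
      |d| ≤ 27648 / (r * Real.sqrt r) / (1 + (x - y) ^ 2 / r) := by
    intro s hs
    have hs0 : 0 < s := hr.trans_le hs.1
    obtain ⟨d, hd, hb⟩ := pt_deriv2 s x y hs0 hx hy
    refine ⟨d, hd, hb.trans ?_⟩
    have h0 : 0 < Real.sqrt r := Real.sqrt_pos.2 hr
    have h1 : Real.sqrt r ≤ Real.sqrt s := Real.sqrt_le_sqrt hs.1
    have h2 : (1 + (x - y) ^ 2 / r) / 2 ≤ 1 + (x - y) ^ 2 / s := by
      have : (x - y) ^ 2 / (2 * r) ≤ (x - y) ^ 2 / s := by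
        gcongr; linarith [hs.2]
      have e : (x - y) ^ 2 / (2 * r) = (x - y) ^ 2 / r / 2 := by field_simp
      linarith
    calc _ ≤ 13824 / (r * Real.sqrt r) / ((1 + (x - y) ^ 2 / r) / 2) := by
          gcongr
          exact hs.1
      _ = _ := by field_simp; norm_num
  choose! d hd hb using key
  have := Convex.norm_image_sub_le_of_norm_hasDerivWithin_le (f := fun s => ptilde s x y)
    (f' := d) (s := Set.Icc r (r + h)) (x := r) (y := r + h)
    (fun s hs => (hd s hs).hasDerivWithinAt) (fun s hs => hb s hs) (convex_Icc _ _)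
    ⟨le_rfl, by linarith⟩ ⟨by linarith, le_rfl⟩
  simp only [Real.norm_eq_abs, add_sub_cancel_left, abs_of_nonneg hh] at this
  refine this.trans (le_of_eq ?_)
  ring

lemma cauchy_int (r x : ℝ) (hr : 0 < r) :
    IntegrableOn (fun y : ℝ => (1 + (x - y) ^ 2 / r)⁻¹) (Set.Ioi 0) ∧
      ∫ y in Set.Ioi (0:ℝ), (1 + (x - y) ^ 2 / r)⁻¹ ≤ Real.pi * Real.sqrt r := by
  have h0 : 0 < Real.sqrt r := Real.sqrt_pos.2 hr
  have e : (fun y : ℝ => (1 + (x - y) ^ 2 / r)⁻¹) =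
      fun y => (fun z : ℝ => (1 + (z / Real.sqrt r) ^ 2)⁻¹) (x - y) := by
    ext y; simp only [div_pow, Real.sq_sqrt hr.le]
  have hI : Integrable (fun y : ℝ => (1 + (x - y) ^ 2 / r)⁻¹) := by
    rw [e]
    exact (integrable_inv_one_add_sq.comp_div h0.ne').comp_sub_left x
  refine ⟨hI.integrableOn, ?_⟩
  calc _ ≤ ∫ y, (1 + (x - y) ^ 2 / r)⁻¹ :=
        setIntegral_le_integral hI (Filter.Eventually.of_forall fun y => by positivity)
    _ = Real.pi * Real.sqrt r := by
      rw [e, integral_sub_left_eq_self (fun z : ℝ => (1 + (z / Real.sqrt r) ^ 2)⁻¹) volume x,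
        Measure.integral_comp_div (fun z : ℝ => (1 + z ^ 2)⁻¹) (Real.sqrt r),
        integral_univ_inv_one_add_sq, abs_of_pos h0, smul_eq_mul, mul_comm]

/-- generic inner bound -/
lemma inner_bound (r x c : ℝ) (hr : 0 < r) (hc : 0 ≤ c) (f : ℝ → ℝ)
    (hf0 : ∀ y > 0, 0 ≤ f y) (hf : ∀ y > 0, f y ≤ c * (1 + (x - y) ^ 2 / r)⁻¹) :
    ∫ y in Set.Ioi (0:ℝ), f y ≤ c * (Real.pi * Real.sqrt r) := by
  obtain ⟨h1, h2⟩ := cauchy_int r x hr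
  calc _ ≤ ∫ y in Set.Ioi (0:ℝ), c * (1 + (x - y) ^ 2 / r)⁻¹ := by
        apply integral_mono_of_nonneg
        · exact (ae_restrict_iff' measurableSet_Ioi).2 (Filter.Eventually.of_forall hf0)
        · exact h1.const_mul c
        · exact (ae_restrict_iff' measurableSet_Ioi).2 (Filter.Eventually.of_forall hf)
    _ = c * ∫ y in Set.Ioi (0:ℝ), (1 + (x - y) ^ 2 / r)⁻¹ := integral_const_mul _ _
    _ ≤ _ := by gcongr

lemma sq_le_aux (b a w : ℝ) (hw : 0 ≤ w) (h : |b| ≤ a / (1 + w)) :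
    b ^ 2 ≤ a ^ 2 * (1 + w)⁻¹ := by
  have h1 : b ^ 2 ≤ (a / (1 + w)) ^ 2 := by
    rw [← sq_abs]; gcongr
  have h2 : (1 + w)⁻¹ ≤ 1 := inv_le_one_of_one_le₀ (by linarith)
  have h3 : 0 ≤ (1 + w)⁻¹ := by positivity
  have h4 : (a / (1 + w)) ^ 2 = a ^ 2 * ((1 + w)⁻¹ * (1 + w)⁻¹) := by
    rw [div_eq_mul_inv]; ring
  rw [h4] at h1
  refine h1.trans ?_
  apply mul_le_mul_of_nonneg_left _ (sq_nonneg a)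
  nlinarith

lemma pt_sq (r x y : ℝ) (hr : 0 < r) (hx : 0 ≤ x) (hy : 0 < y) :
    ptilde r x y ^ 2 ≤ 6912 ^ 2 / r * (1 + (x - y) ^ 2 / r)⁻¹ := by
  have hw : 0 ≤ (x - y) ^ 2 / r := by positivity
  have h0 : 0 < Real.sqrt r := Real.sqrt_pos.2 hr
  have := sq_le_aux (ptilde r x y) (6912 / Real.sqrt r) _ hw (by
    rw [abs_of_nonneg (pt_bound_s7 r x y hr hx hy).1]
    refine (pt_bound2 r x y hr hx hy).trans ?_
    gcongr
    nlinarith)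
  rwa [div_pow, Real.sq_sqrt hr.le] at this

lemma div_sqrt_aux (r : ℝ) (hr : 0 < r) (K : ℝ) :
    K / r * (Real.pi * Real.sqrt r) = K * Real.pi * (1 / Real.sqrt r) := by
  have h0 : 0 < Real.sqrt r := Real.sqrt_pos.2 hr
  have := Real.sq_sqrt hr.le
  field_simp; rw [this]

lemma M1 (r x : ℝ) (hr : 0 < r) (hx : 0 ≤ x) :
    ∫ y in Set.Ioi (0:ℝ), ptilde r x y ^ 2 ≤ 6912 ^ 2 * Real.pi * (1 / Real.sqrt r) := by
  rw [← div_sqrt_aux r hr]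
  exact inner_bound r x _ hr (by positivity) _ (fun y _ => sq_nonneg _)
    (fun y hy => pt_sq r x y hr hx hy)

lemma M3 (r h x : ℝ) (hr : 0 < r) (hh : 0 ≤ h) (hx : 0 ≤ x) :
    ∫ y in Set.Ioi (0:ℝ), (ptilde (r + h) x y - ptilde r x y) ^ 2 ≤
      4 * (6912 ^ 2 * Real.pi) * (1 / Real.sqrt r) := by
  have hrh : 0 < r + h := by linarith
  obtain ⟨h1, h2⟩ := cauchy_int r x hr
  obtain ⟨h3, h4⟩ := cauchy_int (r + h) x hrh
  have h0 : 0 < Real.sqrt r := Real.sqrt_pos.2 hr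
  have h00 : Real.sqrt r ≤ Real.sqrt (r + h) := Real.sqrt_le_sqrt (by linarith)
  calc _ ≤ ∫ y in Set.Ioi (0:ℝ), (2 * (6912 ^ 2 / (r + h)) * (1 + (x - y) ^ 2 / (r + h))⁻¹ +
        2 * (6912 ^ 2 / r) * (1 + (x - y) ^ 2 / r)⁻¹) := by
        apply integral_mono_of_nonneg
        · exact Filter.Eventually.of_forall fun y => sq_nonneg _
        · exact (h3.const_mul _).add (h1.const_mul _)
        · refine (ae_restrict_iff' measurableSet_Ioi).2 (Filter.Eventually.of_forall ?_)
          intro y hy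
          have a1 := pt_sq r x y hr hx hy
          have a2 := pt_sq (r + h) x y hrh hx hy
          have a3 := sq_nonneg (ptilde (r + h) x y + ptilde r x y)
          simp only
          linarith
    _ = 2 * (6912 ^ 2 / (r + h)) * (∫ y in Set.Ioi (0:ℝ), (1 + (x - y) ^ 2 / (r + h))⁻¹) +
        2 * (6912 ^ 2 / r) * ∫ y in Set.Ioi (0:ℝ), (1 + (x - y) ^ 2 / r)⁻¹ := by
      rw [integral_add (h3.const_mul _) (h1.const_mul _), integral_const_mul, integral_const_mul]
    _ ≤ 2 * (6912 ^ 2 / (r + h)) * (Real.pi * Real.sqrt (r + h)) +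
        2 * (6912 ^ 2 / r) * (Real.pi * Real.sqrt r) := by gcongr
    _ = 2 * (6912 ^ 2 * Real.pi * (1 / Real.sqrt (r + h))) +
        2 * (6912 ^ 2 * Real.pi * (1 / Real.sqrt r)) := by
      rw [← div_sqrt_aux r hr, ← div_sqrt_aux (r + h) hrh]; ring
    _ ≤ 2 * (6912 ^ 2 * Real.pi * (1 / Real.sqrt r)) +
        2 * (6912 ^ 2 * Real.pi * (1 / Real.sqrt r)) := by gcongr
    _ = _ := by ring

lemma M2 (r h x : ℝ) (hr : 0 < r) (hh : 0 ≤ h) (hhr : h ≤ r) (hx : 0 ≤ x) :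
    ∫ y in Set.Ioi (0:ℝ), (ptilde (r + h) x y - ptilde r x y) ^ 2 ≤
      16 * (6912 ^ 2 * Real.pi) * (h ^ 2 / r ^ 2 * (1 / Real.sqrt r)) := by
  have h0 : 0 < Real.sqrt r := Real.sqrt_pos.2 hr
  refine (inner_bound r x ((27648 * h / (r * Real.sqrt r)) ^ 2) hr (by positivity) _
    (fun y _ => sq_nonneg _)
    (fun y hy => sq_le_aux _ _ _ (by positivity) (pt_diff r h x y hr hh hhr hx hy))).trans
    (le_of_eq ?_)
  field_simp; ring

lemma M4 (r h x : ℝ) (hr : 0 < r) (hh : 0 < h) (hx : 0 ≤ x) :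
    ∫ y in Set.Ioi (0:ℝ), (ptilde (r + h) x y - ptilde r x y) ^ 2 ≤
      32 * (6912 ^ 2 * Real.pi) * (h / (Real.sqrt r * (r + h))) := by
  have h0 : 0 < Real.sqrt r := Real.sqrt_pos.2 hr
  have e : h / (Real.sqrt r * (r + h)) = h / (r + h) * (1 / Real.sqrt r) := by field_simp
  have hpi := Real.pi_pos
  rw [e]
  rcases le_total h r with hhr | hhr
  · refine (M2 r h x hr hh.le hhr hx).trans ?_
    have : h ^ 2 / r ^ 2 ≤ 2 * (h / (r + h)) := by
      rw [mul_div_assoc', div_le_div_iff₀ (by positivity) (by positivity)]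
      have : h * (r + h) ≤ 2 * r ^ 2 := by nlinarith
      nlinarith
    calc _ ≤ 16 * (6912 ^ 2 * Real.pi) * (2 * (h / (r + h)) * (1 / Real.sqrt r)) := by gcongr
      _ = _ := by ring
  · refine (M3 r h x hr hh.le hx).trans ?_
    have : 1 ≤ 8 * (h / (r + h)) := by
      rw [mul_div_assoc', le_div_iff₀ (by positivity)]; linarith
    calc _ ≤ 4 * (6912 ^ 2 * Real.pi) * (8 * (h / (r + h)) * (1 / Real.sqrt r)) := by
          gcongr
          exact le_mul_of_one_le_left (by positivity) this
      _ = _ := by ring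

/-- generic outer bound -/
lemma outer_bound (a b : ℝ) (hab : a ≤ b) (F g f : ℝ → ℝ) (hF : ContinuousOn F (Set.Icc a b))
    (hd : ∀ r ∈ Set.Ioo a b, HasDerivAt F (g r) r) (hg : ∀ r ∈ Set.Ioo a b, 0 ≤ g r)
    (hf0 : ∀ r, 0 ≤ f r) (hf : ∀ r ∈ Set.Ioc a b, f r ≤ g r) :
    ∫ r in Set.Ioc a b, f r ≤ F b - F a := by
  have hI := intervalIntegral.integrableOn_deriv_of_nonneg hF hd hg
  have h2 := intervalIntegral.integral_eq_sub_of_hasDerivAt_of_le hab hF hd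
    ((intervalIntegrable_iff_integrableOn_Ioc_of_le hab).2 hI)
  rw [← h2, intervalIntegral.integral_of_le hab]
  apply integral_mono_of_nonneg (Filter.Eventually.of_forall hf0) hI
  exact (ae_restrict_iff' measurableSet_Ioc).2 (Filter.Eventually.of_forall hf)

theorem ptilde_time_holder (T : ℝ) (hT : 0 < T) :
    ∃ D > 0, ∀ x : ℝ, 0 ≤ x → ∀ s t : ℝ, 0 ≤ s → s ≤ t → t ≤ T →
      (∫ r in Set.Ioc s t, ∫ y in Set.Ioi (0:ℝ), (ptilde r x y) ^ 2) +
        (∫ r in Set.Ioc (0:ℝ) s, ∫ y in Set.Ioi (0:ℝ),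
          (ptilde (r + (t - s)) x y - ptilde r x y) ^ 2) ≤ D * (t - s) ^ ((1:ℝ)/2) := by
  have hpi := Real.pi_pos
  set C : ℝ := 6912 ^ 2 * Real.pi with hC
  have hC0 : 0 < C := by positivity
  refine ⟨2 * C + 32 * C * Real.pi, by positivity, ?_⟩
  intro x hx s t hs hst htT
  rcases hst.eq_or_lt with rfl | hst'
  · simp
  have hh : 0 < t - s := by linarith
  set h := t - s with hhdef
  rw [← Real.sqrt_eq_rpow]
  have hsh : 0 < Real.sqrt h := Real.sqrt_pos.2 hh
  have A : (∫ r in Set.Ioc s t, ∫ y in Set.Ioi (0:ℝ), (ptilde r x y) ^ 2) ≤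
      2 * C * Real.sqrt h := by
    refine (outer_bound s t hst (fun r => 2 * C * Real.sqrt r) (fun r => C * (1 / Real.sqrt r)) _
      (by fun_prop) ?_ ?_ (fun r => integral_nonneg fun y => sq_nonneg _) ?_).trans ?_
    · intro r hr
      have hr0 : 0 < r := hs.trans_lt hr.1
      refine ((Real.hasDerivAt_sqrt hr0.ne').const_mul (2 * C)).congr_deriv ?_
      have := Real.sqrt_pos.2 hr0
      field_simp
    · intro r _; positivity
    · intro r hr
      exact M1 r x (hs.trans_lt hr.1) hx
    · have : Real.sqrt t ≤ Real.sqrt s + Real.sqrt h := by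
        have e : t = s + h := by rw [hhdef]; ring
        rw [e]; refine Real.sqrt_le_iff.2 ⟨by positivity, ?_⟩
        nlinarith [Real.sq_sqrt hs, Real.sq_sqrt hh.le,
          mul_nonneg (Real.sqrt_nonneg s) (Real.sqrt_nonneg h)]
      nlinarith
  have B : (∫ r in Set.Ioc (0:ℝ) s, ∫ y in Set.Ioi (0:ℝ),
      (ptilde (r + h) x y - ptilde r x y) ^ 2) ≤ 32 * C * Real.pi * Real.sqrt h := by
    refine (outer_bound 0 s hs
      (fun r => 32 * C * (2 * Real.sqrt h * Real.arctan (Real.sqrt r / Real.sqrt h)))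
      (fun r => 32 * C * (h / (Real.sqrt r * (r + h)))) _
      (by fun_prop) ?_ ?_ (fun r => integral_nonneg fun y => sq_nonneg _) ?_).trans ?_
    · intro r hr
      have hr0 : 0 < r := hr.1
      have hsr := Real.sqrt_pos.2 hr0
      refine ((((Real.hasDerivAt_sqrt hr0.ne').div_const (Real.sqrt h)).arctan.const_mul
        (2 * Real.sqrt h)).const_mul (32 * C)).congr_deriv ?_
      rw [div_pow, Real.sq_sqrt hr0.le, Real.sq_sqrt hh.le]
      field_simp
      ring
    · intro r hr
      have := hr.1
      positivity
    · intro r hr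
      exact M4 r h x hr.1 hh hx
    · have := (Real.arctan_lt_pi_div_two (Real.sqrt s / Real.sqrt h)).le
      simp only [Real.sqrt_zero, zero_div, Real.arctan_zero, mul_zero, sub_zero]
      calc _ ≤ 32 * C * (2 * Real.sqrt h * (Real.pi / 2)) := by gcongr
        _ = _ := by ring
  linarith
end
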